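/- arXiv:1210.0835 — 2 statements merged into one kernel-verified Lean document; each statement's English description precedes it below -/
import Mathlib

section
/- Fix integers k and m with 1 ≤ k ≤ m. Then the sum, over all integer tuples (i₁, …, i_k) with −m < i₁ < i₂ < ⋯ < i_k < m and |i_s − i_r| ≥ 2 whenever s ≠ r, of the product ∏_{s=1}^{k} (m² − i_s²), equals the sum, over all integer tuples (j₁, …, j_k) with 1 ≤ j₁ < j₂ < ⋯ < j_k ≤ m, of the product ∏_{s=1}^{k} (2j_s − 1)². -/
/-- Characteristic polynomial recursion of the Kac–Sylvester matrix. -/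
def kacD {R : Type*} [CommRing R] (c x : R) : ℕ → R
  | 0 => 1
  | 1 => x
  | (p + 2) => x * kacD c x (p + 1) - ((p : R) + 1) * (c - p - 1) * kacD c x p

theorem kacD_rec {R : Type*} [CommRing R] (c x : R) (p : ℕ) :
    kacD c x (p + 2) = x * kacD c x (p + 1) - ((p : R) + 1) * (c - p - 1) * kacD c x p := by
  rw [kacD]

theorem kacD_plus {R : Type*} [CommRing R] (c x : R) (p : ℕ) :
    kacD (c + 1) (x + 1) (p + 1) = kacD c x (p + 1) + ((p : R) + 1) * kacD c x p := by
  induction p using Nat.twoStepInduction with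
  | zero => simp [kacD]
  | one => simp [kacD]; ring
  | more p h1 h2 =>
    rw [kacD_rec (c + 1), h1, h2, kacD_rec c x (p + 1), kacD_rec c x p]
    push_cast
    ring

theorem kacD_minus {R : Type*} [CommRing R] (c x : R) (p : ℕ) :
    kacD (c + 1) (x - 1) (p + 1) = kacD c x (p + 1) - ((p : R) + 1) * kacD c x p := by
  induction p using Nat.twoStepInduction with
  | zero => simp [kacD]
  | one => simp [kacD]; ring
  | more p h1 h2 =>
    rw [kacD_rec (c + 1), h1, h2, kacD_rec c x (p + 1), kacD_rec c x p]
    push_cast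
    ring

theorem kacD_top {R : Type*} [CommRing R] (x : R) (n : ℕ) :
    kacD (n : R) x (n + 1) = x * kacD (n : R) x n := by
  cases n with
  | zero => simp [kacD]
  | succ n => rw [kacD_rec]; push_cast; ring

theorem kacD_step {R : Type*} [CommRing R] (x : R) (n : ℕ) :
    kacD ((n + 2 : ℕ) : R) x (n + 2) = (x ^ 2 - ((n : R) + 1) ^ 2) * kacD (n : R) x n := by
  have h1 := kacD_plus ((n + 1 : ℕ) : R) (x - 1) (n + 1)
  have h2 := kacD_minus (n : R) x n
  rw [kacD_top] at h1 h2
  have e : ((n + 2 : ℕ) : R) = ((n + 1 : ℕ) : R) + 1 := by push_cast; ring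
  have e' : ((n + 1 : ℕ) : R) = (n : R) + 1 := by push_cast; ring
  rw [e, show x = x - 1 + 1 by ring, h1, e', h2]
  ring

theorem kacD_even {R : Type*} [CommRing R] (x : R) (m : ℕ) :
    kacD ((2 * m : ℕ) : R) x (2 * m)
      = ∏ j ∈ Finset.range m, (x ^ 2 - (2 * (j : R) + 1) ^ 2) := by
  induction m with
  | zero => simp [kacD]
  | succ m ih =>
    rw [Finset.prod_range_succ, ← ih, show 2 * (m + 1) = 2 * m + 2 by ring, kacD_step]
    push_cast
    ring

/-- Weighted count of sparse `k`-sets. -/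
noncomputable def sparseSum (f : ℤ → ℤ) (a : ℤ) (p k : ℕ) : ℤ :=
  ∑ A ∈ ((Finset.Ioo a (a + p)).powersetCard k).filter
    (fun A => ∀ i ∈ A, ∀ j ∈ A, i ≠ j → 2 ≤ |i - j|), ∏ i ∈ A, f i

theorem sparseSum_zero (f : ℤ → ℤ) (a : ℤ) (p : ℕ) : sparseSum f a p 0 = 1 := by
  simp [sparseSum, Finset.filter_singleton]

theorem sparseSum_small (f : ℤ → ℤ) (a : ℤ) (p k : ℕ) (hp : p ≤ 1) :
    sparseSum f a p (k + 1) = 0 := by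
  have : Finset.Ioo a (a + p) = ∅ := by
    ext i; simp; intro; omega
  rw [sparseSum, this, Finset.powersetCard_eq_empty.2 (by simp)]
  simp

theorem sparseSum_rec (f : ℤ → ℤ) (a : ℤ) (p k : ℕ) :
    sparseSum f a (p + 2) (k + 1)
      = sparseSum f a (p + 1) (k + 1) + f (a + p + 1) * sparseSum f a p k := by
  have hI : Finset.Ioo a (a + (p + 2 : ℕ)) = insert (a + p + 1) (Finset.Ioo a (a + (p + 1 : ℕ))) := by
    ext i; simp; omega
  have hn : a + p + 1 ∉ Finset.Ioo a (a + (p + 1 : ℕ)) := by simp; omega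
  have hset : ((Finset.Ioo a (a + (p + 1 : ℕ))).powersetCard k).filter
      (fun A => ∀ i ∈ insert (a + p + 1) A, ∀ j ∈ insert (a + p + 1) A, i ≠ j → 2 ≤ |i - j|)
      = ((Finset.Ioo a (a + p)).powersetCard k).filter
      (fun A => ∀ i ∈ A, ∀ j ∈ A, i ≠ j → 2 ≤ |i - j|) := by
    ext A
    simp only [Finset.mem_filter, Finset.mem_powersetCard, Finset.subset_iff, Finset.mem_Ioo]
    constructor
    · rintro ⟨⟨h1, h2⟩, h3⟩
      refine ⟨⟨fun i hi => ⟨(h1 hi).1, ?_⟩, h2⟩, fun i hi j hj =>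
        h3 i (Finset.mem_insert_of_mem hi) j (Finset.mem_insert_of_mem hj)⟩
      have h4 := (h1 hi).2
      have h5 := h3 (a + p + 1) (Finset.mem_insert_self _ _) i (Finset.mem_insert_of_mem hi)
        (by push_cast at h4; omega)
      rw [abs_of_nonneg (by push_cast at h4; omega)] at h5
      omega
    · rintro ⟨⟨h1, h2⟩, h3⟩
      refine ⟨⟨fun i hi => ⟨(h1 hi).1, ?_⟩, h2⟩, ?_⟩
      · have := (h1 hi).2
        push_cast; omega
      · intro i hi j hj hij
        rcases Finset.mem_insert.1 hi with rfl | hi <;> rcases Finset.mem_insert.1 hj with rfl | hj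
        · exact absurd rfl hij
        · have := (h1 hj).2
          rw [le_abs]; omega
        · have := (h1 hi).2
          rw [le_abs]; omega
        · exact h3 i hi j hj hij
  have hmem : ∀ A ∈ (Finset.Ioo a (a + (p + 1 : ℕ))).powersetCard k, a + p + 1 ∉ A :=
    fun A hA h => hn ((Finset.mem_powersetCard.1 hA).1 h)
  rw [sparseSum, hI, Finset.powersetCard_succ_insert hn, Finset.filter_union, Finset.sum_union]
  · rw [Finset.filter_image, Finset.sum_image, hset]
    · rw [← sparseSum, sparseSum, sparseSum, Finset.mul_sum]
      congr 1
      rw [← hset]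
      refine Finset.sum_congr rfl fun A hA => ?_
      rw [Finset.prod_insert (hmem A (Finset.mem_filter.1 hA).1)]
    · intro A hA B hB h
      have hA' := hmem A (Finset.mem_filter.1 hA).1
      have hB' := hmem B (Finset.mem_filter.1 hB).1
      have h' : insert (a + p + 1) A = insert (a + p + 1) B := h
      rw [← Finset.erase_insert hA', h', Finset.erase_insert hB']
  · rw [Finset.disjoint_left]
    intro A hA hA2
    obtain ⟨B, -, rfl⟩ := Finset.mem_image.1 (Finset.mem_filter.1 hA2).1
    exact hn ((Finset.mem_powersetCard.1 (Finset.mem_filter.1 hA).1).1 (Finset.mem_insert_self _ _))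

theorem sparseSum_large (f : ℤ → ℤ) (a : ℤ) (p : ℕ) :
    ∀ k, p < 2 * k → sparseSum f a p k = 0 := by
  induction p using Nat.twoStepInduction with
  | zero => rintro (_ | k) h
            · omega
            · exact sparseSum_small _ _ _ _ (by omega)
  | one => rintro (_ | k) h
           · omega
           · exact sparseSum_small _ _ _ _ (by omega)
  | more p h1 h2 =>
    rintro (_ | k) h
    · omega
    · rw [sparseSum_rec, h1 k (by omega), h2 (k + 1) (by omega)]; simp

open Polynomial in
theorem kacD_coeff (m : ℕ) (p : ℕ) : ∀ k j : ℕ, j + 2 * k = p →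
    (kacD ((2 * m : ℕ) : ℤ[X]) X p).coeff j
      = (-1) ^ k * sparseSum (fun i => (m : ℤ) ^ 2 - i ^ 2) (-m) p k := by
  have hdeg : ∀ p j : ℕ, p < j → (kacD ((2 * m : ℕ) : ℤ[X]) X p).coeff j = 0 := by
    intro p
    induction p using Nat.twoStepInduction with
    | zero => intro j hj; simp [kacD, coeff_one]; omega
    | one => intro j hj; simp [kacD, coeff_X]; omega
    | more p h1 h2 =>
      rintro (_ | j) hj
      · omega
      · have e : ((p : ℤ[X]) + 1) * (((2 * m : ℕ) : ℤ[X]) - p - 1)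
          = C (((p : ℤ) + 1) * (2 * m - p - 1)) := by simp
        rw [kacD_rec, e, coeff_sub, coeff_X_mul, coeff_C_mul, h1 _ (by omega), h2 _ (by omega)]
        simp
  induction p using Nat.twoStepInduction with
  | zero =>
    intro k j h
    obtain rfl : k = 0 := by omega
    obtain rfl : j = 0 := by omega
    simp [kacD, sparseSum_zero]
  | one =>
    intro k j h
    obtain rfl : k = 0 := by omega
    obtain rfl : j = 1 := by omega
    simp [kacD, sparseSum_zero]
  | more p h1 h2 =>
    intro k j h
    have e : ((p : ℤ[X]) + 1) * (((2 * m : ℕ) : ℤ[X]) - p - 1)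
      = C (((p : ℤ) + 1) * (2 * m - p - 1)) := by simp
    rw [kacD_rec, e, coeff_sub, coeff_C_mul]
    rcases k with _ | k
    · obtain rfl : j = p + 1 + 1 := by omega
      rw [coeff_X_mul, h2 0 (p + 1) (by omega), hdeg p _ (by omega)]
      simp [sparseSum_zero]
    · rw [sparseSum_rec, h1 k j (by omega)]
      rcases j with _ | j
      · rw [coeff_X_mul_zero, sparseSum_large _ _ (p + 1) (k + 1) (by omega)]
        ring
      · rw [coeff_X_mul, h2 (k + 1) j (by omega)]
        ring


/-- Proposition 2(a): for `1 ≤ k ≤ m`, the sum of `∏_{s=1}^k (m² - i_s²)` over all sets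
`{i₁ < ⋯ < i_k} ⊆ (-m, m)` of integers that are pairwise at distance `≥ 2` equals the sum of
`∏_{s=1}^k (2 j_s - 1)²` over all sets `{j₁ < ⋯ < j_k} ⊆ {1, …, m}`. -/
theorem proposition2a (k m : ℕ) (hk : 1 ≤ k) (hkm : k ≤ m) :
    (∑ A ∈ ((Finset.Ioo (-(m : ℤ)) (m : ℤ)).powersetCard k).filter
        (fun A => ∀ i ∈ A, ∀ j ∈ A, i ≠ j → 2 ≤ |i - j|),
        ∏ i ∈ A, ((m : ℤ) ^ 2 - i ^ 2))
      = ∑ B ∈ (Finset.Icc (1 : ℤ) (m : ℤ)).powersetCard k,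
          ∏ j ∈ B, (2 * j - 1) ^ 2 := by
  have h := kacD_coeff m (2 * m) k (2 * (m - k)) (by omega)
  have hL : (∑ A ∈ ((Finset.Ioo (-(m : ℤ)) (m : ℤ)).powersetCard k).filter
        (fun A => ∀ i ∈ A, ∀ j ∈ A, i ≠ j → 2 ≤ |i - j|),
        ∏ i ∈ A, ((m : ℤ) ^ 2 - i ^ 2))
      = sparseSum (fun i => (m : ℤ) ^ 2 - i ^ 2) (-m) (2 * m) k := by
    rw [sparseSum, show -(m : ℤ) + (2 * m : ℕ) = m by push_cast; ring]
  rw [hL]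
  have hP : kacD ((2 * m : ℕ) : Polynomial ℤ) Polynomial.X (2 * m)
      = Polynomial.expand ℤ 2 (∏ j ∈ Finset.Icc (1 : ℤ) (m : ℤ),
        (Polynomial.X + Polynomial.C (-(2 * j - 1) ^ 2))) := by
    rw [kacD_even, map_prod]
    refine Finset.prod_bij (fun j _ => (j : ℤ) + 1) ?_ ?_ ?_ ?_
    · intro j hj
      simp at hj ⊢; omega
    · intro i _ j _ hij
      simpa using hij
    · intro j hj
      simp at hj
      exact ⟨(j - 1).toNat, by simp; omega, by omega⟩
    · intro j _
      rw [map_add, Polynomial.expand_X, Polynomial.expand_C]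
      simp
      ring
  have h2 : (-1 : ℤ) ^ k * (-1) ^ k = 1 := by rw [← mul_pow]; simp
  rw [hP, mul_comm 2 (m - k), Polynomial.coeff_expand_mul (by norm_num),
    Finset.prod_X_add_C_coeff _ _ (by simp)] at h
  have hc : (Finset.Icc (1 : ℤ) (m : ℤ)).card - (m - k) = k := by simp; omega
  rw [hc] at h
  have h3 : ∀ B ∈ (Finset.Icc (1 : ℤ) (m : ℤ)).powersetCard k,
      ∏ j ∈ B, (-(2 * j - 1) ^ 2) = (-1) ^ k * ∏ j ∈ B, (2 * j - 1) ^ 2 := by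
    intro B hB
    rw [Finset.prod_neg, (Finset.mem_powersetCard.1 hB).2]
  rw [Finset.sum_congr rfl h3, ← Finset.mul_sum] at h
  exact (mul_left_cancel₀ (pow_ne_zero k (by norm_num)) h).symm
end

section
/- Let m ≥ 1 and n = 2m+1, and consider admissible walks from −n to n all of whose steps lie in {−2, +4}. Let X_n(1) denote the (finite) set of such walks that have exactly one step equal to −2 (and hence exactly m+1 steps equal to +4). Then Σ_{x ∈ X_n(1)} h₁(x) = 0, where h₁(x) = ∏_{t=1}^{ν} (n² − j(t)²)^{-1}. -/
/-- The vertex `j(t) = -n + Σ_{i=1}^t x(i)` of a walk `l` from `-n` to `n`. -/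
def vertex (n : ℤ) (l : List ℤ) (t : ℕ) : ℤ := -n + (l.take t).sum

/-- A walk from `-n` to `n`: a sequence of `ν + 1 ≥ 2` nonzero even steps summing to `2n`. -/
def IsWalk (n : ℤ) (l : List ℤ) : Prop :=
  2 ≤ l.length ∧ (∀ s ∈ l, s ≠ 0 ∧ Even s) ∧ l.sum = 2 * n

/-- An admissible walk: the intermediate vertices `j(t)` (`1 ≤ t ≤ ν`) avoid `±n`. -/
def IsAdmissibleWalk (n : ℤ) (l : List ℤ) : Prop :=
  IsWalk n l ∧ ∀ t : ℕ, 1 ≤ t → t + 1 ≤ l.length →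
    vertex n l t ≠ n ∧ vertex n l t ≠ -n

/-- `h₁(x) = ∏_{t=1}^{ν} (n² - j(t)²)⁻¹`, as a rational number. -/
def h1 (n : ℤ) (l : List ℤ) : ℚ :=
  ∏ t ∈ Finset.Icc 1 (l.length - 1), ((n : ℚ) ^ 2 - ((vertex n l t : ℤ) : ℚ) ^ 2)⁻¹

def wk (m k : ℕ) : List ℤ := List.replicate k 4 ++ (-2) :: List.replicate (m + 1 - k) 4

lemma wk_length (m k : ℕ) (hk : k ≤ m + 1) : (wk m k).length = m + 2 := by
  simp [wk]; omega

lemma wk_vertex (m k t : ℕ) (n : ℤ) (hk : k ≤ m + 1) (ht : t ≤ m + 2) :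
    vertex n (wk m k) t = -n + if t ≤ k then 4 * (t : ℤ) else 4 * (t : ℤ) - 6 := by
  unfold vertex wk
  congr 1
  rw [List.take_append]
  split_ifs with h
  · have : t - k = 0 := by omega
    simp [this, List.take_replicate, h, mul_comm]
  · obtain ⟨d, rfl⟩ : ∃ d, t = k + d + 1 := ⟨t - k - 1, by omega⟩
    have h1 : k + d + 1 - k = d + 1 := by omega
    have h2 : min (k + d + 1) k = k := by omega
    have h3 : min d (m + 1 - k) = d := by omega
    simp [h1, List.take_replicate, h2, h3]
    ring

lemma wk_inj (m k k' : ℕ) (h : wk m k = wk m k') : k = k' := by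
  have e : ∀ k, (wk m k).idxOf (-2) = k := by
    intro k
    rw [wk, List.idxOf_append_of_notMem (by simp [List.mem_replicate])]
    simp
  rw [← e k, h, e]

lemma wk_set (m : ℕ) (hm : 1 ≤ m) :
    {l : List ℤ | IsAdmissibleWalk (2 * (m : ℤ) + 1) l ∧ (∀ s ∈ l, s = -2 ∨ s = 4) ∧
              l.count (-2) = 1} = ↑((Finset.range (m + 2)).image (wk m)) := by
  ext l
  simp only [Set.mem_setOf_eq, Finset.coe_image, Set.mem_image, Finset.coe_range, Set.mem_Iio]
  constructor
  · rintro ⟨⟨⟨_, _, hs⟩, _⟩, h4, hc⟩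
    have hmem : (-2 : ℤ) ∈ l := by
      rw [← List.count_pos_iff]; omega
    obtain ⟨s, t, rfl⟩ := List.append_of_mem hmem
    simp only [List.count_append, List.count_cons_self] at hc
    have hs0 : (-2 : ℤ) ∉ s := by rw [← List.count_eq_zero]; omega
    have ht0 : (-2 : ℤ) ∉ t := by rw [← List.count_eq_zero]; omega
    have es : s = List.replicate s.length 4 := by
      rw [List.eq_replicate_iff]
      refine ⟨rfl, fun b hb => ?_⟩
      rcases h4 b (by simp [hb]) with rfl | h
      · exact absurd hb hs0
      · exact h
    have et : t = List.replicate t.length 4 := by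
      rw [List.eq_replicate_iff]
      refine ⟨rfl, fun b hb => ?_⟩
      rcases h4 b (by simp [hb]) with rfl | h
      · exact absurd hb ht0
      · exact h
    have hss : s.sum = 4 * (s.length : ℤ) := by
      conv_lhs => rw [es]
      simp [mul_comm]
    have hts : t.sum = 4 * (t.length : ℤ) := by
      conv_lhs => rw [et]
      simp [mul_comm]
    simp only [List.sum_append, List.sum_cons, hss, hts] at hs
    refine ⟨s.length, by omega, ?_⟩
    have : m + 1 - s.length = t.length := by omega
    rw [wk, this, ← es, ← et]
  · rintro ⟨k, hk, rfl⟩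
    have hl := wk_length m k (by omega)
    refine ⟨⟨⟨by omega, ?_, ?_⟩, ?_⟩, ?_, ?_⟩
    · intro s hs
      simp only [wk, List.mem_append, List.mem_cons, List.mem_replicate] at hs
      rcases hs with ⟨_, rfl⟩ | rfl | ⟨_, rfl⟩ <;> exact ⟨by decide, by decide⟩
    · simp [wk]
      push_cast [Nat.cast_sub (show k ≤ m + 1 by omega)]
      ring
    · intro t h1 h2
      rw [wk_vertex m k t _ (by omega) (by omega)]
      split_ifs <;> constructor <;> omega
    · intro s hs
      simp only [wk, List.mem_append, List.mem_cons, List.mem_replicate] at hs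
      tauto
    · simp [wk, List.count_replicate]

def fac (m k t : ℕ) : ℚ :=
  if t ≤ k then 8 * (t : ℚ) * (2 * m + 1 - 2 * t) else 8 * ((m : ℚ) + 2 - t) * (2 * t - 3)

lemma h1_wk (m k : ℕ) (hk : k ≤ m + 1) :
    h1 (2 * (m : ℤ) + 1) (wk m k) = ∏ t ∈ Finset.Icc 1 (m + 1), (fac m k t)⁻¹ := by
  unfold h1
  rw [wk_length m k hk]
  refine Finset.prod_congr rfl fun t ht => ?_
  rw [Finset.mem_Icc] at ht
  rw [wk_vertex m k t _ hk (by omega), fac]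
  congr 1
  split_ifs <;> push_cast <;> ring

lemma ratio (m k : ℕ) (hk : k ≤ m) :
    h1 (2 * (m : ℤ) + 1) (wk m (k + 1)) * ((k + 1) * (2 * m - 1 - 2 * k)) =
      h1 (2 * (m : ℤ) + 1) (wk m k) * ((m + 1 - k) * (2 * k - 1)) := by
  rw [h1_wk m _ (by omega), h1_wk m _ (by omega)]
  have hmem : k + 1 ∈ Finset.Icc 1 (m + 1) := by simp; omega
  rw [← Finset.mul_prod_erase _ _ hmem, ← Finset.mul_prod_erase _ _ hmem]
  have : ∏ t ∈ (Finset.Icc 1 (m + 1)).erase (k + 1), (fac m (k + 1) t)⁻¹ =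
      ∏ t ∈ (Finset.Icc 1 (m + 1)).erase (k + 1), (fac m k t)⁻¹ := by
    refine Finset.prod_congr rfl fun t ht => ?_
    have hne := Finset.ne_of_mem_erase ht
    have : t ≤ k + 1 ↔ t ≤ k := by omega
    simp [fac, this]
  rw [this]
  have e1 : fac m (k + 1) (k + 1) = 8 * (((k : ℚ) + 1) * (2 * m - 1 - 2 * k)) := by
    simp [fac]; ring
  have e2 : fac m k (k + 1) = 8 * (((m : ℚ) + 1 - k) * (2 * k - 1)) := by
    simp [fac]; ring
  have n1 : ((k : ℚ) + 1) * (2 * m - 1 - 2 * k) ≠ 0 := by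
    have : ((k : ℤ) + 1) * (2 * m - 1 - 2 * k) ≠ 0 := mul_ne_zero (by omega) (by omega)
    exact_mod_cast this
  have n2 : ((m : ℚ) + 1 - k) * (2 * k - 1) ≠ 0 := by
    have : ((m : ℤ) + 1 - k) * (2 * k - 1) ≠ 0 := mul_ne_zero (by omega) (by omega)
    exact_mod_cast this
  rw [e1, e2]
  generalize ((k : ℚ) + 1) * (2 * m - 1 - 2 * k) = A at *
  generalize ((m : ℚ) + 1 - k) * (2 * k - 1) = B at *
  field_simp

lemma partial_sum (m K : ℕ) (hK : K ≤ m + 1) :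
    (m * (m + 1) : ℚ) * ∑ k ∈ Finset.range K, h1 (2 * (m : ℤ) + 1) (wk m k) =
      (2 * K - m - 2) * K * (2 * m + 1 - 2 * K) * h1 (2 * (m : ℤ) + 1) (wk m K) := by
  induction K with
  | zero => simp
  | succ K ih =>
    rw [Finset.sum_range_succ, mul_add, ih (by omega)]
    have := ratio m K (by omega)
    push_cast
    linear_combination (-(2 * (K : ℚ) - m)) * this

/-- For `n = 2m + 1`, the sum of `h₁(x)` over all admissible walks from `-n` to `n` with steps
in `{-2, +4}` having exactly one step equal to `-2` vanishes. -/
theorem B1_eq_zero (m : ℕ) (hm : 1 ≤ m) :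
    (∑ᶠ (l : List ℤ)
        (_ : IsAdmissibleWalk (2 * (m : ℤ) + 1) l ∧ (∀ s ∈ l, s = -2 ∨ s = 4) ∧
              l.count (-2) = 1),
        h1 (2 * (m : ℤ) + 1) l) = 0 := by
  have key := finsum_mem_congr (wk_set m hm)
    (fun l _ => (rfl : h1 (2 * (m : ℤ) + 1) l = h1 (2 * (m : ℤ) + 1) l))
  simp only [Set.mem_setOf_eq] at key
  rw [key, finsum_mem_coe_finset, Finset.sum_image (fun a _ b _ h => wk_inj m a b h)]
  have h := partial_sum m (m + 1) le_rfl
  rw [Finset.sum_range_succ]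
  have hne : (m * (m + 1) : ℚ) ≠ 0 := by positivity
  apply mul_left_cancel₀ hne
  rw [mul_add, h]
  push_cast
  ring
end
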